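/- (Geometric duality theorem.) Assume S ≠ ∅ and T ≠ ∅. Then Ψ is an inclusion-reversing one-to-one map between the set of all R*-maximal proper faces of 𝒟 and the set of all R-minimal proper faces of 𝒫 (inclusion-reversing means F₁* ⊆ F₂* ⟺ Ψ(F₁*) ⊇ Ψ(F₂*)); its inverse is Ψ⁻¹(F) = ⋂_{y∈F} {w ∈ 𝒟 : φ(y,w) = 0}; and for every R*-maximal proper face F* of 𝒟 one has dim F* + dim Ψ(F*) = q − 1. -/

import Mathlib

open Matrix Set Pointwise

noncomputable section

/-- `cone B = {l • x : l ≥ 0, x ∈ conv B}` -/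
def coneOf {E : Type*} [AddCommGroup E] [Module ℝ E] (B : Set E) : Set E :=
  {y | ∃ l : ℝ, 0 ≤ l ∧ ∃ x ∈ convexHull ℝ B, y = l • x}

/-- `F` is a face of the convex set `B`. -/
def IsFaceOf {E : Type*} [AddCommGroup E] [Module ℝ E] (F B : Set E) : Prop :=
  Convex ℝ F ∧ F ⊆ B ∧
    ∀ y ∈ B, ∀ z ∈ B, ∀ l : ℝ, 0 < l → l < 1 → l • y + (1 - l) • z ∈ F → y ∈ F ∧ z ∈ F

/-- recession cone `0⁺B` of a convex set. -/
def recCone {E : Type*} [AddCommGroup E] [Module ℝ E] (B : Set E) : Set E :=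
  {d | ∀ x ∈ B, ∀ t : ℝ, 0 ≤ t → x + t • d ∈ B}

/-- lineality space `L(B) = 0⁺B ∩ (−0⁺B)`. -/
def linealOf {E : Type*} [AddCommGroup E] [Module ℝ E] (B : Set E) : Set E :=
  recCone B ∩ -recCone B

/-- dimension of (the affine hull of) a set. -/
def sdim {E : Type*} [AddCommGroup E] [Module ℝ E] (B : Set E) : ℕ :=
  Module.finrank ℝ (vectorSpan ℝ B)

def IsPolyhedron {d : ℕ} (B : Set (Fin d → ℝ)) : Prop :=
  ∃ (k : ℕ) (W : Matrix (Fin k) (Fin d) ℝ) (v : Fin k → ℝ), B = {x | v ≤ W.mulVec x}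

/-- orthogonal complement (as a set) of a set of vectors. -/
def orthSet {d : ℕ} (L : Set (Fin d → ℝ)) : Set (Fin d → ℝ) :=
  {y | ∀ z ∈ L, y ⬝ᵥ z = 0}

/-- polar cone `K° = {w : ∀ y ∈ K, wᵀy ≤ 0}`. -/
def polarCone {d : ℕ} (K : Set (Fin d → ℝ)) : Set (Fin d → ℝ) :=
  {w | ∀ y ∈ K, w ⬝ᵥ y ≤ 0}

/-- the last index of `Fin q` (1-based index `q`). -/
def lastIdx (q : ℕ) (hq : 0 < q) : Fin q := ⟨q - 1, by omega⟩

/-- `y ↦ (y,1)`. -/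
def lift1 {q : ℕ} (y : Fin q → ℝ) : Fin (q + 1) → ℝ := Fin.snoc y 1

/-- `y ↦ (y,0)`. -/
def lift0 {q : ℕ} (y : Fin q → ℝ) : Fin (q + 1) → ℝ := Fin.snoc y 0

/-- `p(y) = (y₁,…,y_q)`. -/
def projq {q : ℕ} (y : Fin (q + 1) → ℝ) : Fin q → ℝ := fun i => y i.castSucc

/-- `Φ(B) = cl cone (B × {1})`. -/
def PhiMap {q : ℕ} (B : Set (Fin q → ℝ)) : Set (Fin (q + 1) → ℝ) :=
  closure (coneOf (lift1 '' B))

/-- the block matrix `G = (A; −ZᵀP; 0)`. -/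
def Gmat {m n q r : ℕ} (A : Matrix (Fin m) (Fin n) ℝ) (P : Matrix (Fin q) (Fin n) ℝ)
    (Z : Matrix (Fin q) (Fin r) ℝ) : Matrix (Fin (m + r + 1)) (Fin n) ℝ :=
  fun i j =>
    if h : (i : ℕ) < m then A ⟨i, h⟩ j
    else if h2 : (i : ℕ) < m + r then -(∑ l : Fin q, Z l ⟨(i : ℕ) - m, by omega⟩ * P l j)
    else 0

/-- the block matrix `H` with rows `(0, −b)`, `(Zᵀ, 0)` and `(0,…,0,1)`. -/
def Hmat {m q r : ℕ} (b : Fin m → ℝ) (Z : Matrix (Fin q) (Fin r) ℝ) :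
    Matrix (Fin (m + r + 1)) (Fin (q + 1)) ℝ :=
  fun i j =>
    if h : (i : ℕ) < m then (if (j : ℕ) = q then -b ⟨i, h⟩ else 0)
    else if h2 : (i : ℕ) < m + r then
      (if hj : (j : ℕ) < q then Z ⟨j, hj⟩ ⟨(i : ℕ) - m, by omega⟩ else 0)
    else (if (j : ℕ) = q then 1 else 0)

/-- dual objective `D(u,w) = (w₁,…,w_{q−1}, bᵀu)`. -/
def Dmap {m q : ℕ} (b : Fin m → ℝ) (uw : (Fin m → ℝ) × (Fin q → ℝ)) : Fin q → ℝ :=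
  fun i => if (i : ℕ) < q - 1 then uw.2 i else b ⬝ᵥ uw.1

/-- `R* = {v : v₁ = ⋯ = v_{q−1} = 0, v_q ≥ 0}`. -/
def RstarSet (q : ℕ) (hq : 0 < q) : Set (Fin q → ℝ) :=
  {v | (∀ i : Fin q, (i : ℕ) < q - 1 → v i = 0) ∧ 0 ≤ v (lastIdx q hq)}

/-- dual feasible set `T`. -/
def Tset {m n q r : ℕ} (A : Matrix (Fin m) (Fin n) ℝ) (P : Matrix (Fin q) (Fin n) ℝ)
    (Z : Matrix (Fin q) (Fin r) ℝ) (cbar : Fin q → ℝ) :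
    Set ((Fin m → ℝ) × (Fin q → ℝ)) :=
  {uw | ∃ v : Fin r → ℝ, 0 ≤ v ∧ uw.2 = Z.mulVec v ∧
    Aᵀ.mulVec uw.1 = Pᵀ.mulVec uw.2 ∧ cbar ⬝ᵥ uw.2 = 1 ∧ 0 ≤ uw.1}

/-- `φ(y,w) = Σ_{i<q} y_i w_i + y_q (1 − Σ_{i<q} c̄_i w_i) − w_q`. -/
def phiFn {q : ℕ} (hq : 0 < q) (cbar : Fin q → ℝ) (y w : Fin q → ℝ) : ℝ :=
  (∑ i : Fin q, if (i : ℕ) < q - 1 then y i * w i else 0)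
    + y (lastIdx q hq) * (1 - ∑ i : Fin q, if (i : ℕ) < q - 1 then cbar i * w i else 0)
    - w (lastIdx q hq)

/-- duality map `Ψ(F*) = ⋂_{w ∈ F*} {y ∈ Pset : φ(y,w) = 0}`. -/
def PsiMap {q : ℕ} (hq : 0 < q) (cbar : Fin q → ℝ) (Pset : Set (Fin q → ℝ))
    (Fstar : Set (Fin q → ℝ)) : Set (Fin q → ℝ) :=
  ⋂ w ∈ Fstar, {y ∈ Pset | phiFn hq cbar y w = 0}

/-- `My = (−y₁,…,−y_{q−1}, c̄₁y₁+⋯+c̄_{q−1}y_{q−1} − y_{q+1}, y_q)`. -/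
def Mmap {q : ℕ} (hq : 0 < q) (cbar : Fin q → ℝ) (y : Fin (q + 1) → ℝ) : Fin (q + 1) → ℝ :=
  fun i =>
    if (i : ℕ) < q - 1 then -y i
    else if (i : ℕ) = q - 1 then
      (∑ j : Fin q, if (j : ℕ) < q - 1 then cbar j * y j.castSucc else 0) - y (Fin.last q)
    else y ((lastIdx q hq).castSucc)

/-- `M⁻¹w = (−w₁,…,−w_{q−1}, w_{q+1}, −cᵀw)` where `c = (c̄,0)`. -/
def MinvMap {q : ℕ} (cbar : Fin q → ℝ) (w : Fin (q + 1) → ℝ) : Fin (q + 1) → ℝ :=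
  fun i =>
    if (i : ℕ) < q - 1 then -w i
    else if (i : ℕ) = q - 1 then w (Fin.last q)
    else -((Fin.snoc cbar 0 : Fin (q + 1) → ℝ) ⬝ᵥ w)

/-- `p*(w) = (w₁,…,w_{q−1},w_{q+1})`. -/
def pstarMap {q : ℕ} (w : Fin (q + 1) → ℝ) : Fin q → ℝ :=
  fun i => if (i : ℕ) < q - 1 then w i.castSucc else w (Fin.last q)

/-- `y` generates an extreme ray of the pointed convex cone `Q`. -/
def IsExtremeDir {E : Type*} [AddCommGroup E] [Module ℝ E] (Q : Set E) (y : E) : Prop :=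
  y ∈ Q ∧ y ≠ 0 ∧ IsFaceOf (coneOf {y}) Q

/-- `σ(u,w) = (u¹, −p(w))` where `u = (u¹,u²,u³) ∈ ℝ^m×ℝ^r×ℝ`. -/
def sigmaMap {m q r : ℕ} (uw : (Fin (m + r + 1) → ℝ) × (Fin (q + 1) → ℝ)) :
    (Fin m → ℝ) × (Fin q → ℝ) :=
  (fun i => uw.1 (Fin.castLE (by omega) i), -projq uw.2)

open PointedCone in
/-- Adding a ray to a polyhedral cone yields a polyhedral cone (Fourier–Motzkin elimination). -/
lemma dualFG_sup_hull_singleton {M N : Type*} [AddCommGroup M] [Module ℝ M] [AddCommGroup N]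
    [Module ℝ N] (p : M →ₗ[ℝ] N →ₗ[ℝ] ℝ) {K : PointedCone ℝ N} (hK : K.DualFG p) (c : N) :
    (K ⊔ hull ℝ {c}).DualFG p := by
  classical
  obtain ⟨s, rfl⟩ := hK
  refine ⟨{a ∈ s | 0 ≤ p a c} ∪ Finset.image₂ (fun a a' => p a c • a' - p a' c • a)
    {a ∈ s | 0 < p a c} {a ∈ s | p a c < 0}, le_antisymm (fun x hx => ?_) (sup_le ?_ ?_)⟩
  · have hx₁ : ∀ a ∈ s, 0 ≤ p a c → 0 ≤ p a x := fun a ha hac => by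
      apply hx; simp [ha, hac]
    have hx₂ : ∀ a ∈ s, ∀ a' ∈ s, 0 < p a c → p a' c < 0 →
        0 ≤ p a c * p a' x - p a' c * p a x := fun a ha a' ha' hac hac' => by
      have : p a c • a' - p a' c • a ∈ Finset.image₂ (fun a a' => p a c • a' - p a' c • a)
          {a ∈ s | 0 < p a c} {a ∈ s | p a c < 0} :=
        Finset.mem_image₂_of_mem (by simp [ha, hac]) (by simp [ha', hac'])
      simpa using hx (Finset.mem_coe.2 (Finset.mem_union_right _ this))
    let L := insert 0 ({a ∈ s | p a c < 0}.image fun a => p a x / p a c)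
    obtain ⟨t, htL, ht⟩ := L.exists_max_image id ⟨0, by simp [L]⟩
    simp only [id] at ht
    have ht0 : 0 ≤ t := ht 0 (by simp [L])
    have htx : x - t • c ∈ dual p (s : Set M) := fun a ha => by
      simp only [map_sub, map_smul, smul_eq_mul, sub_nonneg]
      rcases lt_trichotomy (p a c) 0 with h | h | h
      · have := ht (p a x / p a c) (Finset.mem_insert_of_mem
          (Finset.mem_image_of_mem _ (by simpa [h] using ha)))
        rwa [div_le_iff_of_neg h] at this
      · simpa [h] using hx₁ a ha h.ge
      · rcases Finset.mem_insert.1 htL with rfl | h'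
        · simpa using hx₁ a ha h.le
        · obtain ⟨a', ha', rfl⟩ := Finset.mem_image.1 h'
          rw [Finset.mem_filter] at ha'
          have := hx₂ a ha a' ha'.1 h ha'.2
          rw [div_mul_eq_mul_div, div_le_iff_of_neg ha'.2]
          linarith
    rw [← sub_add_cancel x (t • c)]
    exact add_mem (le_sup_left (a := dual p (s : Set M)) htx)
      (le_sup_right (a := dual p (s : Set M))
        (Submodule.smul_mem _ (⟨t, ht0⟩ : {t : ℝ // 0 ≤ t}) (subset_hull rfl)))
  · intro x hx a ha
    rw [Finset.mem_coe, Finset.mem_union, Finset.mem_image₂] at ha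
    rcases ha with ha | ⟨a, ha, a', ha', rfl⟩
    · exact hx (Finset.mem_filter.1 ha).1
    · rw [Finset.mem_filter] at ha ha'
      have h₁ := hx ha.1
      have h₂ := hx ha'.1
      simp only [map_sub, map_smul, LinearMap.sub_apply, LinearMap.smul_apply, smul_eq_mul]
      nlinarith
  · refine Submodule.span_le.2 (Set.singleton_subset_iff.2 fun a ha => ?_)
    rw [Finset.mem_coe, Finset.mem_union, Finset.mem_image₂] at ha
    rcases ha with ha | ⟨a, ha, a', ha', rfl⟩
    · exact (Finset.mem_filter.1 ha).2
    · simp [mul_comm]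

open PointedCone in
/-- Minkowski–Weyl: a finitely generated cone is a finite intersection of half-spaces. -/
lemma PointedCone.dualFG_of_fg {M N : Type*} [AddCommGroup M] [Module ℝ M] [Module.Finite ℝ M]
    [AddCommGroup N] [Module ℝ N] (p : M →ₗ[ℝ] N →ₗ[ℝ] ℝ) [p.IsPerfPair] {K : PointedCone ℝ N}
    (hK : K.FG) : K.DualFG p := by
  classical
  obtain ⟨t, rfl⟩ := hK
  induction t using Finset.induction_on with
  | empty =>
    have := DualFG.dual_of_fg p (Submodule.FG.restrictScalars (R := {t : ℝ // 0 ≤ t})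
      (Module.Finite.fg_top (R := ℝ) (M := M)))
    convert this
    simpa using (dual_univ (LinearMap.IsPerfPair.bijective_right p).injective).symm
  | insert c t _ ih =>
    rw [Finset.coe_insert, Submodule.span_insert, sup_comm]
    exact dualFG_sup_hull_singleton p ih c

open PointedCone in
/-- Farkas' lemma: a finitely generated cone equals its bidual. -/
lemma PointedCone.dual_dual_of_fg {M N : Type*} [AddCommGroup M] [Module ℝ M] [Module.Finite ℝ M]
    [AddCommGroup N] [Module ℝ N] (p : M →ₗ[ℝ] N →ₗ[ℝ] ℝ) [p.IsPerfPair] {K : PointedCone ℝ N}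
    (hK : K.FG) : dual p (dual p.flip (K : Set N)) = K :=
  (dualFG_of_fg p hK).dual_dual_flip

open PointedCone in
/-- Minkowski–Weyl: a finite intersection of half-spaces is finitely generated. -/
lemma PointedCone.fg_of_dualFG {M N : Type*} [AddCommGroup M] [Module ℝ M] [Module.Finite ℝ M]
    [AddCommGroup N] [Module ℝ N] [Module.Finite ℝ N] (p : M →ₗ[ℝ] N →ₗ[ℝ] ℝ) [p.IsPerfPair]
    {K : PointedCone ℝ N} (hK : K.DualFG p) : K.FG := by
  obtain ⟨D, hD, rfl⟩ := hK.exists_fg_dual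
  obtain ⟨s, rfl⟩ := dualFG_of_fg p.flip hD
  have := dual_dual_of_fg p (Submodule.fg_span (R := {t : ℝ // 0 ≤ t}) s.finite_toSet)
  rw [dual_hull] at this
  rw [this]
  exact Submodule.fg_span s.finite_toSet

/-- `F` is a nonempty face of `B` no point of which can be moved inside `B` in direction `-k`. -/
def IsMinFace {E : Type*} [AddCommGroup E] [Module ℝ E] (B : Set E) (k : E) (F : Set E) : Prop :=
  IsFaceOf F B ∧ F.Nonempty ∧ ∀ x ∈ F, ∀ ε : ℝ, 0 < ε → x - ε • k ∉ B

/-- The part on which `e` takes the value `1` of a cone `K`. -/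
def coneSlice {M N : Type*} [AddCommGroup M] [Module ℝ M] [AddCommGroup N] [Module ℝ N]
    (p : M →ₗ[ℝ] N →ₗ[ℝ] ℝ) (K : PointedCone ℝ N) (e : M) : Set N :=
  {x | x ∈ K ∧ p e x = 1}

/-- The elements of a slice of the dual cone which vanish on `F`. -/
def slicePolar {M N : Type*} [AddCommGroup M] [Module ℝ M] [AddCommGroup N] [Module ℝ N]
    (p : M →ₗ[ℝ] N →ₗ[ℝ] ℝ) (L : PointedCone ℝ M) (k : N) (F : Set N) : Set M :=
  {ξ ∈ coneSlice p.flip L k | ∀ x ∈ F, p ξ x = 0}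

/-- Finitely many linear forms, nonnegative on a convex set and none of which vanishes identically
on it, are simultaneously positive at some point of the set. -/
lemma exists_mem_forall_pos {M N : Type*} [AddCommGroup M] [Module ℝ M] [AddCommGroup N]
    [Module ℝ N] (p : M →ₗ[ℝ] N →ₗ[ℝ] ℝ) {F : Set N} (hF : Convex ℝ F) (hne : F.Nonempty)
    {s : Set M} (hs : s.Finite) (hnn : ∀ ξ ∈ s, ∀ x ∈ F, 0 ≤ p ξ x)
    (hpos : ∀ ξ ∈ s, ∃ x ∈ F, p ξ x ≠ 0) : ∃ x ∈ F, ∀ ξ ∈ s, 0 < p ξ x := by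
  induction s, hs using Set.Finite.induction_on with
  | empty => obtain ⟨x, hx⟩ := hne; exact ⟨x, hx, by simp⟩
  | @insert a s _ _ ih =>
    obtain ⟨x, hx, hxs⟩ := ih (fun ξ h => hnn ξ (Or.inr h)) (fun ξ h => hpos ξ (Or.inr h))
    obtain ⟨y, hy, hya⟩ := hpos a (Or.inl rfl)
    refine ⟨(1 / 2 : ℝ) • x + (1 / 2 : ℝ) • y,
      hF hx hy (by norm_num) (by norm_num) (by norm_num), fun ξ hξ => ?_⟩
    have hx0 := hnn ξ hξ x hx
    have hy0 := hnn ξ hξ y hy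
    simp only [map_add, map_smul, smul_eq_mul]
    rcases hξ with rfl | hξ
    · have := hy0.lt_of_ne' hya; linarith
    · have := hxs ξ hξ; linarith

/-- From a point of a polyhedral cone one can move a little in every direction along which the
active constraints do not decrease. -/
lemma exists_pos_add_smul_mem_dual {M N : Type*} [AddCommGroup M] [Module ℝ M] [AddCommGroup N]
    [Module ℝ N] (p : M →ₗ[ℝ] N →ₗ[ℝ] ℝ) {s : Set M} (hs : s.Finite) (e : M) {x d : N}
    (hx : ∀ ξ ∈ s, 0 < p ξ x ∨ 0 ≤ p ξ x ∧ 0 ≤ p ξ d) (he : 0 < p e x) :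
    ∃ ε : ℝ, 0 < ε ∧ x + ε • d ∈ PointedCone.dual p s ∧ 0 < p e (x + ε • d) := by
  have key : ∀ ξ, 0 < p ξ x → ∀ᶠ ε : ℝ in nhdsWithin 0 (Ioi 0), 0 < p ξ (x + ε • d) := by
    intro ξ h
    have hc : Continuous fun ε : ℝ => p ξ (x + ε • d) := by
      simp only [map_add, map_smul, smul_eq_mul]; fun_prop
    exact (hc.continuousAt.eventually_mem (isOpen_Ioi.mem_nhds (by simpa using h))).filter_mono
      nhdsWithin_le_nhds
  have h₁ : ∀ ξ ∈ s, ∀ᶠ ε : ℝ in nhdsWithin 0 (Ioi 0), 0 ≤ p ξ (x + ε • d) := by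
    intro ξ hξ
    rcases hx ξ hξ with h | ⟨h, h'⟩
    · exact (key ξ h).mono fun _ => le_of_lt
    · filter_upwards [self_mem_nhdsWithin] with ε hε
      simp only [map_add, map_smul, smul_eq_mul]
      exact add_nonneg h (mul_nonneg (le_of_lt hε) h')
  obtain ⟨ε, hε, h, h'⟩ := (Filter.Eventually.and (self_mem_nhdsWithin (s := Ioi (0 : ℝ)))
    (((Filter.eventually_all_finite hs).2 h₁).and (key e he))).exists
  exact ⟨ε, hε, fun ξ hξ => h ξ hξ, h'⟩

section Slice

variable {M N : Type*} [AddCommGroup M] [Module ℝ M] [AddCommGroup N] [Module ℝ N]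
  {p : M →ₗ[ℝ] N →ₗ[ℝ] ℝ} {s : Set M} {e : M} {k : N} {F : Set N}

/-- A face of a slice of a polyhedral cone contains a point at which only those constraints are
active that are active on the whole face. -/
lemma IsMinFace.exists_mem_pos (hs : s.Finite)
    (hF : IsMinFace (coneSlice p (PointedCone.dual p s) e) k F) :
    ∃ x ∈ F, ∀ ξ ∈ s, 0 < p ξ x ∨ ∀ y ∈ F, p ξ y = 0 := by
  obtain ⟨x, hx, hpos⟩ := exists_mem_forall_pos p hF.1.1 hF.2.1
    (s := {ξ ∈ s | ∃ x ∈ F, p ξ x ≠ 0}) (hs.subset (sep_subset _ _))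
    (fun ξ hξ x hx => (hF.1.2.1 hx).1 hξ.1) (fun ξ hξ => hξ.2)
  refine ⟨x, hx, fun ξ hξ => ?_⟩
  by_cases h : ∃ x ∈ F, p ξ x ≠ 0
  · exact Or.inl (hpos ξ ⟨hξ, h⟩)
  · push Not at h
    exact Or.inr h

/-- A face of a slice of a polyhedral cone is cut out by the constraints active on it. -/
lemma IsMinFace.mem_of_forall (hs : s.Finite)
    (hF : IsMinFace (coneSlice p (PointedCone.dual p s) e) k F) {x : N}
    (hx : x ∈ coneSlice p (PointedCone.dual p s) e)
    (h : ∀ ξ ∈ s, (∀ y ∈ F, p ξ y = 0) → p ξ x = 0) : x ∈ F := by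
  obtain ⟨x₀, hx₀, hpos⟩ := hF.exists_mem_pos hs
  have hx₀e := (hF.1.2.1 hx₀).2
  obtain ⟨ε, hε, hmem, -⟩ := exists_pos_add_smul_mem_dual p hs e (x := x₀) (d := x₀ - x)
    (fun ξ hξ => (hpos ξ hξ).imp id fun h' => by simp [h' x₀ hx₀, h ξ hξ h']) (by simp [hx₀e])
  have hmem' : x₀ + ε • (x₀ - x) ∈ coneSlice p (PointedCone.dual p s) e :=
    ⟨hmem, by simp [hx₀e, hx.2]⟩
  have h1 : (0 : ℝ) < 1 + ε := by linarith
  refine (hF.1.2.2 _ hmem' _ hx (1 / (1 + ε)) (by positivity)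
    ((div_lt_one h1).2 (by linarith)) ?_).2
  convert hx₀ using 1
  match_scalars <;> field_simp
  ring

/-- The polar of a minimal face is nonempty. -/
lemma IsMinFace.exists_mem_slicePolar (hs : s.Finite)
    (hek : p e k = 0) (hF : IsMinFace (coneSlice p (PointedCone.dual p s) e) k F) :
    (slicePolar p (PointedCone.dual p.flip (PointedCone.dual p s : Set N)) k F).Nonempty := by
  obtain ⟨x₀, hx₀, hpos⟩ := hF.exists_mem_pos hs
  have hx₀e := (hF.1.2.1 hx₀).2
  by_cases h : ∃ ξ ∈ s, (∀ y ∈ F, p ξ y = 0) ∧ 0 < p ξ k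
  · obtain ⟨ξ, hξ, hξF, hξk⟩ := h
    refine ⟨(p ξ k)⁻¹ • ξ, ⟨fun x hx => ?_, ?_⟩, fun y hy => ?_⟩
    · have : 0 ≤ p ξ x := hx hξ
      simp only [LinearMap.flip_apply, map_smul, smul_eq_mul]
      positivity
    · simp [hξk.ne']
    · simp [hξF y hy]
  · push Not at h
    obtain ⟨ε, hε, hmem, -⟩ := exists_pos_add_smul_mem_dual p hs e (x := x₀) (d := -k)
      (fun ξ hξ => (hpos ξ hξ).imp id fun h' => by simp [h' x₀ hx₀, h ξ hξ h']) (by simp [hx₀e])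
    refine absurd ?_ (hF.2.2 x₀ hx₀ ε hε)
    rw [sub_eq_add_neg, ← smul_neg]
    exact ⟨hmem, by simp [hx₀e, hek]⟩

/-- An active constraint vanishes wherever the polar of a minimal face does. -/
lemma IsMinFace.eq_zero_of_forall_slicePolar (hs : s.Finite) (hk : k ∈ PointedCone.dual p s)
    (hek : p e k = 0) (hF : IsMinFace (coneSlice p (PointedCone.dual p s) e) k F) {x : N}
    (hx : ∀ ξ ∈ slicePolar p (PointedCone.dual p.flip (PointedCone.dual p s : Set N)) k F,
      p ξ x = 0) {ξ : M} (hξ : ξ ∈ s) (hξF : ∀ y ∈ F, p ξ y = 0) : p ξ x = 0 := by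
  obtain ⟨ξ₀, hξ₀⟩ := hF.exists_mem_slicePolar hs hek
  have h1 : 0 < 1 + p ξ k := by have : 0 ≤ p ξ k := hk hξ; linarith
  have hξ₀k : p ξ₀ k = 1 := hξ₀.1.2
  have := hx ((1 + p ξ k)⁻¹ • (ξ₀ + ξ)) ⟨⟨fun y hy => ?_, ?_⟩, fun y hy => ?_⟩
  · simpa [hx ξ₀ hξ₀, h1.ne'] using this
  · have h2 : 0 ≤ p ξ y := hy hξ
    have h3 : 0 ≤ p ξ₀ y := hξ₀.1.1 hy
    simp only [LinearMap.flip_apply, map_smul, smul_eq_mul, map_add]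
    positivity
  · simp only [LinearMap.flip_apply, map_smul, map_add, hξ₀k, smul_eq_mul]
    exact inv_mul_cancel₀ h1.ne'
  · simp [hξF y hy, hξ₀.2 y hy]

/-- A minimal face equals its bipolar. -/
lemma IsMinFace.slicePolar_slicePolar (hs : s.Finite) (hk : k ∈ PointedCone.dual p s)
    (hek : p e k = 0) (hF : IsMinFace (coneSlice p (PointedCone.dual p s) e) k F) :
    slicePolar p.flip (PointedCone.dual p s) e
      (slicePolar p (PointedCone.dual p.flip (PointedCone.dual p s : Set N)) k F) = F := by
  refine Subset.antisymm (fun x hx => ?_) fun x hx => ⟨hF.1.2.1 hx, fun ξ hξ => hξ.2 x hx⟩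
  exact hF.mem_of_forall hs hx.1 fun ξ hξ hξF =>
    hF.eq_zero_of_forall_slicePolar hs hk hek (fun ξ' hξ' => hx.2 ξ' hξ') hξ hξF

/-- The linear span of a minimal face is the annihilator of its polar. -/
lemma IsMinFace.mem_span_iff (hs : s.Finite) (hk : k ∈ PointedCone.dual p s)
    (hek : p e k = 0) (hF : IsMinFace (coneSlice p (PointedCone.dual p s) e) k F) {x : N} :
    x ∈ Submodule.span ℝ F ↔
      ∀ ξ ∈ slicePolar p (PointedCone.dual p.flip (PointedCone.dual p s : Set N)) k F,
        p ξ x = 0 := by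
  refine ⟨fun hx ξ hξ => ?_, fun hx => ?_⟩
  · exact (Submodule.span_le (p := LinearMap.ker (p ξ))).2 (fun y hy => hξ.2 y hy) hx
  · obtain ⟨x₀, hx₀, hpos⟩ := hF.exists_mem_pos hs
    have hJ : ∀ ξ ∈ s, (∀ y ∈ F, p ξ y = 0) → p ξ x = 0 := fun ξ hξ hξF =>
      hF.eq_zero_of_forall_slicePolar hs hk hek hx hξ hξF
    obtain ⟨ε, hε, hmem, he⟩ := exists_pos_add_smul_mem_dual p hs e (x := x₀) (d := x)
      (fun ξ hξ => (hpos ξ hξ).imp id fun h' => by simp [h' x₀ hx₀, hJ ξ hξ h'])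
      (by simp [(hF.1.2.1 hx₀).2])
    have hy : (p e (x₀ + ε • x))⁻¹ • (x₀ + ε • x) ∈ F := by
      refine hF.mem_of_forall hs ⟨fun ξ hξ => ?_, ?_⟩ fun ξ hξ hξF => ?_
      · have := hmem hξ
        rw [map_smul, smul_eq_mul]
        positivity
      · rw [map_smul, smul_eq_mul, inv_mul_cancel₀ he.ne']
      · simp [hJ ξ hξ hξF, hξF x₀ hx₀]
    have hz : x₀ + ε • x ∈ Submodule.span ℝ F := by
      rw [← smul_inv_smul₀ he.ne' (x₀ + ε • x)]
      exact Submodule.smul_mem _ _ (Submodule.subset_span hy)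
    rw [← inv_smul_smul₀ hε.ne' x, ← add_sub_cancel_left x₀ (ε • x)]
    exact Submodule.smul_mem _ _ (sub_mem hz (Submodule.subset_span hx₀))

/-- Sets on whose slice a linear form is constantly `1` have span one dimension larger than their
affine hull. -/
lemma finrank_span_eq_sdim_add_one [Module.Finite ℝ N] (l : N →ₗ[ℝ] ℝ) (hne : F.Nonempty)
    (hl : ∀ x ∈ F, l x = 1) : Module.finrank ℝ (Submodule.span ℝ F) = sdim F + 1 := by
  obtain ⟨x₀, hx₀⟩ := hne
  have hsup : Submodule.span ℝ F = vectorSpan ℝ F ⊔ Submodule.span ℝ {x₀} := by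
    refine le_antisymm (Submodule.span_le.2 fun x hx => ?_) (sup_le ?_ ?_)
    · rw [← sub_add_cancel x x₀]
      exact add_mem (Submodule.mem_sup_left (vsub_mem_vectorSpan ℝ hx hx₀))
        (Submodule.mem_sup_right (Submodule.mem_span_singleton_self x₀))
    · rw [vectorSpan_def, Submodule.span_le]
      rintro _ ⟨x, hx, y, hy, rfl⟩
      exact sub_mem (Submodule.subset_span hx) (Submodule.subset_span hy)
    · exact Submodule.span_mono (Set.singleton_subset_iff.2 hx₀)
  have hker : vectorSpan ℝ F ≤ LinearMap.ker l := by
    rw [vectorSpan_def, Submodule.span_le]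
    rintro _ ⟨x, hx, y, hy, rfl⟩
    simp [hl x hx, hl y hy]
  have hx₀0 : x₀ ≠ 0 := fun h => by simpa [h] using hl x₀ hx₀
  have hinf : vectorSpan ℝ F ⊓ Submodule.span ℝ {x₀} = ⊥ := by
    refine (Submodule.eq_bot_iff _).2 fun x ⟨hx, hx'⟩ => ?_
    obtain ⟨t, rfl⟩ := Submodule.mem_span_singleton.1 hx'
    have : t = 0 := by simpa [hl x₀ hx₀] using hker hx
    simp [this]
  have := Submodule.finrank_sup_add_finrank_inf_eq (vectorSpan ℝ F) (Submodule.span ℝ {x₀})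
  rw [hinf, finrank_bot, finrank_span_singleton hx₀0, ← hsup] at this
  simpa [sdim] using this

/-- Dimension formula for a minimal face and its polar. -/
lemma IsMinFace.sdim_add_sdim_slicePolar [Module.Finite ℝ M] [Module.Finite ℝ N] [p.IsPerfPair]
    (hs : s.Finite) (hk : k ∈ PointedCone.dual p s)
    (hek : p e k = 0) (hF : IsMinFace (coneSlice p (PointedCone.dual p s) e) k F) :
    sdim F + sdim (slicePolar p (PointedCone.dual p.flip (PointedCone.dual p s : Set N)) k F) + 2
      = Module.finrank ℝ N := by
  set G := slicePolar p (PointedCone.dual p.flip (PointedCone.dual p s : Set N)) k F with hG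
  have h₁ := finrank_span_eq_sdim_add_one (p e) hF.2.1 fun x hx => (hF.1.2.1 hx).2
  have h₂ := finrank_span_eq_sdim_add_one (p.flip k) (hF.exists_mem_slicePolar hs hek)
    fun ξ hξ => hξ.1.2
  have hspan : Submodule.span ℝ F = ((Submodule.span ℝ G).map p).dualCoannihilator := by
    ext x
    rw [hF.mem_span_iff hs hk hek, Submodule.mem_dualCoannihilator, ← hG]
    simp only [Submodule.mem_map, forall_exists_index, and_imp, forall_apply_eq_imp_iff₂]
    refine ⟨fun h ξ hξ => ?_, fun h ξ hξ => h ξ (Submodule.subset_span hξ)⟩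
    exact (Submodule.span_le (p := LinearMap.ker (p.flip x))).2 (fun y hy => h y hy) hξ
  have h₃ := Subspace.finrank_add_finrank_dualCoannihilator_eq ((Submodule.span ℝ G).map p)
  rw [← hspan, ← (Submodule.equivMapOfInjective p
    (LinearMap.IsPerfPair.bijective_left p).injective _).finrank_eq] at h₃
  rw [← hG] at h₂
  omega

end Slice

lemma sdim_image {E N : Type*} [AddCommGroup E] [Module ℝ E] [AddCommGroup N] [Module ℝ N]
    (f : E →ᵃ[ℝ] N) (hf : Function.Injective f) (F : Set E) : sdim (f '' F) = sdim F := by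
  rw [sdim, sdim, ← AffineMap.map_vectorSpan]
  exact (Submodule.equivMapOfInjective f.linear (f.linear_injective_iff.2 hf) _).finrank_eq.symm

lemma IsFaceOf.image {E N : Type*} [AddCommGroup E] [Module ℝ E] [AddCommGroup N] [Module ℝ N]
    (f : E →ᵃ[ℝ] N) (hf : Function.Injective f) {B F : Set E} (hF : IsFaceOf F B) :
    IsFaceOf (f '' F) (f '' B) := by
  refine ⟨hF.1.affine_image f, image_mono hF.2.1, ?_⟩
  rintro _ ⟨y, hy, rfl⟩ _ ⟨z, hz, rfl⟩ l hl hl' h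
  rw [← Convex.combo_affine_apply (f := f) (by ring : l + (1 - l) = 1),
    hf.mem_set_image] at h
  obtain ⟨h₁, h₂⟩ := hF.2.2 y hy z hz l hl hl' h
  exact ⟨mem_image_of_mem f h₁, mem_image_of_mem f h₂⟩

lemma IsMinFace.image {E N : Type*} [AddCommGroup E] [Module ℝ E] [AddCommGroup N] [Module ℝ N]
    (f : E →ᵃ[ℝ] N) (hf : Function.Injective f) {B F : Set E} {k : E} (hF : IsMinFace B k F) :
    IsMinFace (f '' B) (f.linear k) (f '' F) := by
  refine ⟨hF.1.image f hf, hF.2.1.image f, ?_⟩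
  rintro _ ⟨x, hx, rfl⟩ ε hε h
  have : f x - ε • f.linear k = f (x - ε • k) := by
    rw [← map_smul, sub_eq_add_neg (a := x), add_comm, ← vadd_eq_add, f.map_vadd, vadd_eq_add,
      map_neg, neg_add_eq_sub]
  rw [this, hf.mem_set_image] at h
  exact hF.2.2 x hx ε hε h

/-- Geometric duality for two affine slices `B₁`, `B₂` of a polyhedral cone and its dual. -/
lemma IsMinFace.polar_of_slices {E₁ E₂ M N : Type*} [AddCommGroup E₁] [Module ℝ E₁]
    [AddCommGroup E₂] [Module ℝ E₂] [AddCommGroup M] [Module ℝ M] [Module.Finite ℝ M]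
    [AddCommGroup N] [Module ℝ N] [Module.Finite ℝ N] {p : M →ₗ[ℝ] N →ₗ[ℝ] ℝ} [p.IsPerfPair]
    {K : PointedCone ℝ N} {L : PointedCone ℝ M} (hK : K.DualFG p)
    (hL : PointedCone.dual p.flip (K : Set N) = L)
    {f : E₁ →ᵃ[ℝ] N} (hf : Function.Injective f) {g : E₂ →ᵃ[ℝ] M} (hg : Function.Injective g)
    {B₁ : Set E₁} {B₂ : Set E₂} {e : M} {c : E₁} (hk : f.linear c ∈ K) (hek : p e (f.linear c) = 0)
    (hB₁ : f '' B₁ = coneSlice p K e) (hB₂ : g '' B₂ = coneSlice p.flip L (f.linear c))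
    {F : Set E₁} (hF : IsMinFace B₁ c F) {G : Set E₂}
    (hG : G = {w ∈ B₂ | ∀ y ∈ F, p (g w) (f y) = 0}) :
    G.Nonempty ∧ {y ∈ B₁ | ∀ w ∈ G, p (g w) (f y) = 0} = F ∧
      sdim F + sdim G + 2 = Module.finrank ℝ N := by
  obtain ⟨s, rfl⟩ := hK
  subst hL
  have hF' := hF.image f hf
  rw [hB₁] at hF'
  have hGi : g '' G = slicePolar p (PointedCone.dual p.flip (PointedCone.dual p s : Set N))
      (f.linear c) (f '' F) := by
    rw [slicePolar, ← hB₂, hG]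
    ext ξ
    constructor
    · rintro ⟨w, ⟨hw, h⟩, rfl⟩
      exact ⟨mem_image_of_mem g hw, by simpa using h⟩
    · rintro ⟨⟨w, hw, rfl⟩, h⟩
      exact ⟨w, ⟨hw, by simpa using h⟩, rfl⟩
  have h₁ := hF'.exists_mem_slicePolar s.finite_toSet hek
  have h₂ := hF'.slicePolar_slicePolar s.finite_toSet hk hek
  have h₃ := hF'.sdim_add_sdim_slicePolar s.finite_toSet hk hek
  rw [← hGi] at h₁ h₂ h₃
  rw [sdim_image f hf, sdim_image g hg] at h₃
  refine ⟨h₁.of_image, ?_, h₃⟩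
  rw [← hf.image_injective.eq_iff, ← h₂, slicePolar, LinearMap.flip_flip, ← hB₁]
  ext x
  constructor
  · rintro ⟨y, ⟨hy, h⟩, rfl⟩
    exact ⟨mem_image_of_mem f hy, by simpa using h⟩
  · rintro ⟨⟨y, hy, rfl⟩, h⟩
    exact ⟨y, ⟨hy, by simpa using h⟩, rfl⟩

/-- The common zero set in `B` of nonnegative affine functions increasing in direction `c` is a
minimal face as soon as it is nonempty. -/
lemma isMinFace_setOf_forall_eq_zero {E ι : Type*} [AddCommGroup E] [Module ℝ E] {B : Set E}
    (hB : Convex ℝ B) {c : E} {I : Set ι} (hI : I.Nonempty) (a : ι → E →ᵃ[ℝ] ℝ)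
    (ha : ∀ i ∈ I, ∀ x ∈ B, 0 ≤ a i x) (hc : ∀ i ∈ I, (a i).linear c = 1)
    (hne : {x ∈ B | ∀ i ∈ I, a i x = 0}.Nonempty) :
    IsMinFace B c {x ∈ B | ∀ i ∈ I, a i x = 0} := by
  refine ⟨⟨fun x hx y hy s t hs ht hst => ⟨hB hx.1 hy.1 hs ht hst, fun i hi => ?_⟩,
    sep_subset _ _, fun y hy z hz l hl hl' h => ?_⟩, hne, fun x hx ε hε h => ?_⟩
  · rw [Convex.combo_affine_apply hst, hx.2 i hi, hy.2 i hi]; simp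
  · have : ∀ i ∈ I, a i y = 0 ∧ a i z = 0 := fun i hi => by
      have h0 := h.2 i hi
      rw [Convex.combo_affine_apply (by ring), smul_eq_mul, smul_eq_mul] at h0
      have hy0 := ha i hi y hy
      have hz0 := ha i hi z hz
      have h1l : 0 < 1 - l := by linarith
      constructor <;> nlinarith [mul_nonneg hl.le hy0, mul_nonneg h1l.le hz0]
    exact ⟨⟨hy, fun i hi => (this i hi).1⟩, hz, fun i hi => (this i hi).2⟩
  · obtain ⟨i, hi⟩ := hI
    have h0 := ha i hi _ h
    rw [sub_eq_add_neg, add_comm, ← vadd_eq_add, AffineMap.map_vadd, map_neg, map_smul, hc i hi,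
      hx.2 i hi] at h0
    simp only [smul_eq_mul, mul_one, vadd_eq_add, add_zero] at h0
    linarith

/-- The pairing `((v, s), (y, t)) ↦ vᵀy + st` on `ℝ^q × ℝ`. -/
def homogPairing (q : ℕ) : ((Fin q → ℝ) × ℝ) →ₗ[ℝ] ((Fin q → ℝ) × ℝ) →ₗ[ℝ] ℝ :=
  LinearMap.mk₂ ℝ (fun a x => a.1 ⬝ᵥ x.1 + a.2 * x.2)
    (fun a a' x => by simp [add_dotProduct]; ring)
    (fun t a x => by simp [mul_add, mul_assoc])
    (fun a x x' => by simp [dotProduct_add]; ring)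
    (fun t a x => by simp; ring)

@[simp] lemma homogPairing_apply {q : ℕ} (a x : (Fin q → ℝ) × ℝ) :
    homogPairing q a x = a.1 ⬝ᵥ x.1 + a.2 * x.2 := rfl

lemma homogPairing_flip (q : ℕ) : (homogPairing q).flip = homogPairing q :=
  LinearMap.ext₂ fun a x => by simp [dotProduct_comm, mul_comm]

lemma homogPairing_injective (q : ℕ) : Function.Injective (homogPairing q) := by
  refine (injective_iff_map_eq_zero _).2 fun a ha => Prod.ext ?_ ?_
  · refine dotProduct_eq_zero _ fun v => ?_
    simpa using LinearMap.congr_fun ha (v, 0)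
  · simpa using LinearMap.congr_fun ha (0, 1)

instance (q : ℕ) : (homogPairing q).IsPerfPair :=
  .of_injective (homogPairing_injective q) (by
    rw [homogPairing_flip]; exact homogPairing_injective q)

/-- The affine embedding `y ↦ (y, 1)`. -/
def upperLift (q : ℕ) : (Fin q → ℝ) →ᵃ[ℝ] (Fin q → ℝ) × ℝ where
  toFun y := (y, 1)
  linear := LinearMap.inl ℝ (Fin q → ℝ) ℝ
  map_vadd' y v := by simp

@[simp] lemma upperLift_apply {q : ℕ} (y : Fin q → ℝ) : upperLift q y = (y, 1) := rfl

@[simp] lemma upperLift_linear {q : ℕ} (y : Fin q → ℝ) : (upperLift q).linear y = (y, 0) := rfl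

lemma upperLift_injective (q : ℕ) : Function.Injective (upperLift q) :=
  fun _ _ h => congrArg Prod.fst h

/-- The linear part of `lowerLift`. -/
def lowerLiftLinear {q : ℕ} (hq : 0 < q) (cbar : Fin q → ℝ) :
    (Fin q → ℝ) →ₗ[ℝ] (Fin q → ℝ) × ℝ where
  toFun w := (fun i => if (i : ℕ) < q - 1 then w i else
    -∑ j : Fin q, if (j : ℕ) < q - 1 then cbar j * w j else 0, -w (lastIdx q hq))
  map_add' w w' := by
    refine Prod.ext (funext fun i => ?_) (by simp; ring)
    by_cases hi : (i : ℕ) < q - 1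
    · simp [hi]
    · simp only [hi, if_false, Pi.add_apply, Prod.mk_add_mk, ← neg_add, ← Finset.sum_add_distrib]
      congr 1
      exact Finset.sum_congr rfl fun j _ => by split_ifs <;> ring
  map_smul' t w := by
    refine Prod.ext (funext fun i => ?_) (by simp)
    by_cases hi : (i : ℕ) < q - 1
    · simp [hi]
    · simp only [hi, if_false, Pi.smul_apply, Prod.smul_mk, RingHom.id_apply, smul_eq_mul,
        mul_neg, Finset.mul_sum]
      congr 1
      exact Finset.sum_congr rfl fun j _ => by split_ifs <;> ring

/-- The affine embedding of `ℝ^q` onto `{(v, s) | c̄ᵀv = 1}` with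
`φ(y, w) = ⟨lowerLift w, (y, 1)⟩`. -/
def lowerLift {q : ℕ} (hq : 0 < q) (cbar : Fin q → ℝ) : (Fin q → ℝ) →ᵃ[ℝ] (Fin q → ℝ) × ℝ :=
  (lowerLiftLinear hq cbar).toAffineMap +
    AffineMap.const ℝ (Fin q → ℝ)
      ((fun i : Fin q => if (i : ℕ) < q - 1 then 0 else 1, 0) : (Fin q → ℝ) × ℝ)

lemma lowerLift_apply {q : ℕ} (hq : 0 < q) (cbar w : Fin q → ℝ) :
    lowerLift hq cbar w = (fun i : Fin q => if (i : ℕ) < q - 1 then w i else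
      1 - ∑ j : Fin q, if (j : ℕ) < q - 1 then cbar j * w j else 0, -w (lastIdx q hq)) := by
  refine Prod.ext (funext fun i => ?_) (by simp [lowerLift, lowerLiftLinear])
  by_cases hi : (i : ℕ) < q - 1
  · simp [lowerLift, lowerLiftLinear, hi]
  · simp [lowerLift, lowerLiftLinear, hi, neg_add_eq_sub]

lemma lowerLift_linear {q : ℕ} (hq : 0 < q) (cbar : Fin q → ℝ) :
    (lowerLift hq cbar).linear = lowerLiftLinear hq cbar := by
  simp [lowerLift]

lemma eq_lastIdx_of_not_lt {q : ℕ} (hq : 0 < q) {i : Fin q} (hi : ¬ (i : ℕ) < q - 1) :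
    i = lastIdx q hq :=
  Fin.ext (by simp only [lastIdx]; omega)

lemma not_lastIdx_lt {q : ℕ} (hq : 0 < q) : ¬ (lastIdx q hq : ℕ) < q - 1 := by
  simp [lastIdx]

lemma sum_eq_sum_ite_add_lastIdx {q : ℕ} (hq : 0 < q) (x : Fin q → ℝ) :
    ∑ i, x i = (∑ i : Fin q, if (i : ℕ) < q - 1 then x i else 0) + x (lastIdx q hq) := by
  have h : ∀ i : Fin q, x i = (if (i : ℕ) < q - 1 then x i else 0) +
      if i = lastIdx q hq then x i else 0 := fun i => by
    by_cases hi : (i : ℕ) < q - 1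
    · have : i ≠ lastIdx q hq := fun h => not_lastIdx_lt hq (h ▸ hi)
      simp [hi, this]
    · simp [hi, ← eq_lastIdx_of_not_lt hq hi]
  rw [Finset.sum_congr rfl fun i _ => h i, Finset.sum_add_distrib]
  simp

lemma lowerLift_injective {q : ℕ} (hq : 0 < q) (cbar : Fin q → ℝ) :
    Function.Injective (lowerLift hq cbar) := fun w w' h => funext fun i => by
  rw [lowerLift_apply, lowerLift_apply, Prod.mk.injEq] at h
  by_cases hi : (i : ℕ) < q - 1
  · simpa [hi] using congrFun h.1 i
  · rw [eq_lastIdx_of_not_lt hq hi]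
    exact neg_injective h.2

lemma phiFn_eq_homogPairing {q : ℕ} (hq : 0 < q) (cbar y w : Fin q → ℝ) :
    phiFn hq cbar y w = homogPairing q (lowerLift hq cbar w) (upperLift q y) := by
  simp only [homogPairing_apply, upperLift_apply, lowerLift_apply, dotProduct]
  rw [sum_eq_sum_ite_add_lastIdx hq, phiFn, if_neg (not_lastIdx_lt hq)]
  have : ∀ i : Fin q, (if (i : ℕ) < q - 1 then (if (i : ℕ) < q - 1 then w i else
      1 - ∑ j : Fin q, if (j : ℕ) < q - 1 then cbar j * w j else 0) * y i else 0) =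
      if (i : ℕ) < q - 1 then y i * w i else 0 := fun i => by
    split_ifs <;> ring
  simp only [this]
  ring

/-- The points of the hyperplane `c̄ᵀv = 1` are determined by their first `q - 1` coordinates. -/
lemma lowerLift_eq_iff {q : ℕ} (hq : 0 < q) {cbar : Fin q → ℝ} (hcq : cbar (lastIdx q hq) = 1)
    (w : Fin q → ℝ) (ξ : (Fin q → ℝ) × ℝ) : lowerLift hq cbar w = ξ ↔
      cbar ⬝ᵥ ξ.1 = 1 ∧ (∀ i : Fin q, (i : ℕ) < q - 1 → w i = ξ.1 i) ∧
        w (lastIdx q hq) = -ξ.2 := by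
  rw [dotProduct, sum_eq_sum_ite_add_lastIdx hq, hcq, one_mul]
  constructor
  · rintro rfl
    simp only [lowerLift_apply, not_lastIdx_lt, if_false, neg_neg, and_true]
    refine ⟨?_, fun i hi => by simp [hi]⟩
    rw [add_sub, sub_eq_iff_eq_add, add_comm, add_right_inj]
    exact Finset.sum_congr rfl fun i _ => by split_ifs <;> rfl
  · rintro ⟨h₁, h₂, h₃⟩
    refine Prod.ext (funext fun i => ?_) (by simp [lowerLift_apply, h₃])
    by_cases hi : (i : ℕ) < q - 1
    · simp [lowerLift_apply, hi, h₂]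
    · simp only [lowerLift_apply, hi, if_false]
      rw [eq_lastIdx_of_not_lt hq hi, sub_eq_iff_eq_add, ← h₁, add_comm, add_right_inj]
      exact Finset.sum_congr rfl fun j _ => by
        split_ifs with hj
        · rw [h₂ j hj]
        · rfl

/-- The inequalities `Ax ≥ tb`, `Zᵀ(y - Px) ≥ 0`, `t ≥ 0` as linear forms in `(x, y, t)`. -/
def homogRow {m n q r : ℕ} (A : Matrix (Fin m) (Fin n) ℝ) (P : Matrix (Fin q) (Fin n) ℝ)
    (Z : Matrix (Fin q) (Fin r) ℝ) (b : Fin m → ℝ) :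
    Fin m ⊕ Fin r ⊕ Unit → Module.Dual ℝ ((Fin n → ℝ) × (Fin q → ℝ) × ℝ)
  | .inl i => LinearMap.proj i ∘ₗ A.mulVecLin ∘ₗ LinearMap.fst _ _ _ -
      b i • (LinearMap.snd _ _ _ ∘ₗ LinearMap.snd _ _ _)
  | .inr (.inl j) => LinearMap.proj j ∘ₗ Zᵀ.mulVecLin ∘ₗ
      (LinearMap.fst _ _ _ ∘ₗ LinearMap.snd _ _ _ - P.mulVecLin ∘ₗ LinearMap.fst _ _ _)
  | .inr (.inr _) => LinearMap.snd _ _ _ ∘ₗ LinearMap.snd _ _ _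

/-- The homogenization `{(y, t) | t ≥ 0, ∃ x, Ax ≥ tb, Zᵀ(y - Px) ≥ 0}` of the upper image. -/
def homogCone {m n q r : ℕ} (A : Matrix (Fin m) (Fin n) ℝ) (P : Matrix (Fin q) (Fin n) ℝ)
    (Z : Matrix (Fin q) (Fin r) ℝ) (b : Fin m → ℝ) : PointedCone ℝ ((Fin q → ℝ) × ℝ) :=
  PointedCone.map (LinearMap.snd ℝ (Fin n → ℝ) ((Fin q → ℝ) × ℝ))
    (PointedCone.dual .id (range (homogRow A P Z b)))

section HomogCone

variable {m n q r : ℕ} {A : Matrix (Fin m) (Fin n) ℝ} {P : Matrix (Fin q) (Fin n) ℝ}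
  {Z : Matrix (Fin q) (Fin r) ℝ} {b : Fin m → ℝ}

lemma mem_homogCone_iff {y : Fin q → ℝ} {t : ℝ} : (y, t) ∈ homogCone A P Z b ↔
    0 ≤ t ∧ ∃ x, t • b ≤ A *ᵥ x ∧ 0 ≤ Zᵀ *ᵥ (y - P *ᵥ x) := by
  rw [homogCone, PointedCone.mem_map]
  constructor
  · rintro ⟨⟨x, y, t⟩, h, h'⟩
    obtain ⟨rfl, rfl⟩ := Prod.mk.inj h'
    refine ⟨h ⟨.inr (.inr ()), rfl⟩, x, fun i => ?_, fun j => h ⟨.inr (.inl j), rfl⟩⟩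
    have := h ⟨.inl i, rfl⟩
    simpa [homogRow, mul_comm] using this
  · rintro ⟨ht, x, hx, hy⟩
    refine ⟨(x, y, t), ?_, rfl⟩
    rintro _ ⟨i | j | _, rfl⟩
    · simpa [homogRow, mul_comm] using hx i
    · exact hy j
    · exact ht

lemma homogCone_fg : (homogCone A P Z b).FG :=
  (PointedCone.fg_of_dualFG _ (PointedCone.DualFG.dual_of_finite _ (finite_range _))).map _

/-- Farkas' lemma for the homogenized upper image. -/
lemma mem_dual_homogCone_iff {v : Fin q → ℝ} {s : ℝ} :
    (v, s) ∈ PointedCone.dual (homogPairing q).flip (homogCone A P Z b : Set _) ↔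
      ∃ (u : Fin m → ℝ) (l : Fin r → ℝ), 0 ≤ u ∧ 0 ≤ l ∧ v = Z *ᵥ l ∧
        Aᵀ *ᵥ u = Pᵀ *ᵥ v ∧ -s ≤ b ⬝ᵥ u := by
  constructor
  · intro h
    have hfg : (PointedCone.hull ℝ (range (homogRow A P Z b))).FG :=
      Submodule.fg_span (finite_range _)
    have hmem : homogPairing q (v, s) ∘ₗ LinearMap.snd ℝ (Fin n → ℝ) ((Fin q → ℝ) × ℝ) ∈
        PointedCone.hull ℝ (range (homogRow A P Z b)) := by
      rw [← PointedCone.dual_dual_of_fg LinearMap.id.flip hfg, LinearMap.flip_flip,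
        PointedCone.dual_hull]
      exact fun z hz => h ⟨z, hz, rfl⟩
    obtain ⟨c, hc⟩ := (Submodule.mem_span_range_iff_exists_fun _).1 hmem
    have hc' : ∀ x y t, (∑ i, (c (.inl i) : ℝ) * ((A *ᵥ x) i - b i * t)) +
        (∑ j, (c (.inr (.inl j)) : ℝ) * (Zᵀ *ᵥ (y - P *ᵥ x)) j) + c (.inr (.inr ())) * t =
        v ⬝ᵥ y + s * t := fun x y t => by
      have := LinearMap.congr_fun hc (x, y, t)
      simp only [Fintype.sum_sum_type, LinearMap.add_apply, LinearMap.sum_apply, Finset.univ_unique,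
        Finset.sum_singleton] at this
      rw [add_assoc]
      exact this
    have hv : v = Z *ᵥ fun j => (c (.inr (.inl j)) : ℝ) := by
      refine dotProduct_eq _ _ fun y => ?_
      have := hc' 0 y 0
      rw [← vecMul_transpose, ← dotProduct_mulVec]
      simpa [dotProduct] using this.symm
    refine ⟨fun i => c (.inl i), fun j => c (.inr (.inl j)), fun i => (c _).2, fun j => (c _).2,
      hv, dotProduct_eq _ _ fun x => ?_, ?_⟩
    · have := hc' x 0 0
      simp only [mul_zero, sub_zero, zero_sub, mulVec_neg, Pi.neg_apply, mul_neg, add_zero,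
        Finset.sum_neg_distrib, dotProduct_zero, add_neg_eq_zero] at this
      rw [mulVec_transpose, mulVec_transpose, ← dotProduct_mulVec, ← dotProduct_mulVec, hv,
        ← vecMul_transpose Z, ← dotProduct_mulVec]
      exact this
    · have := hc' 0 0 1
      have h0 := (c (.inr (.inr ()))).2
      simp only [mulVec_zero, Pi.zero_apply, zero_sub, sub_zero, mul_one, mul_neg, mul_zero,
        Finset.sum_neg_distrib, Finset.sum_const_zero, dotProduct_zero, add_zero] at this
      rw [dotProduct_comm, dotProduct]
      linarith
  · rintro ⟨u, l, hu, hl, rfl, hA, hs⟩ ⟨y, t⟩ hyt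
    obtain ⟨ht, x, hx, hy⟩ := mem_homogCone_iff.1 hyt
    have h₁ := dotProduct_le_dotProduct_of_nonneg_left hx hu
    have h₂ := dotProduct_nonneg_of_nonneg hl hy
    rw [dotProduct_mulVec, vecMul_transpose, dotProduct_sub] at h₂
    rw [dotProduct_mulVec, ← mulVec_transpose, hA, mulVec_transpose, ← dotProduct_mulVec,
      dotProduct_smul, smul_eq_mul, dotProduct_comm] at h₁
    have h₃ := mul_le_mul_of_nonneg_left hs ht
    simp only [LinearMap.flip_apply, homogPairing_apply]
    linarith

end HomogCone

section Slices

variable {m n q r : ℕ} {A : Matrix (Fin m) (Fin n) ℝ} {P : Matrix (Fin q) (Fin n) ℝ}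
  {Z : Matrix (Fin q) (Fin r) ℝ} {b : Fin m → ℝ}

lemma mem_upperImage_iff {y : Fin q → ℝ} :
    y ∈ P.mulVec '' {x | b ≤ A *ᵥ x} + {y | 0 ≤ Zᵀ *ᵥ y} ↔ upperLift q y ∈ homogCone A P Z b := by
  rw [upperLift_apply, mem_homogCone_iff, mem_add]
  constructor
  · rintro ⟨_, ⟨x, hx, rfl⟩, z, hz, rfl⟩
    exact ⟨zero_le_one, x, by simpa using hx, by simpa using hz⟩
  · rintro ⟨-, x, hx, hy⟩
    exact ⟨_, ⟨x, by simpa using hx, rfl⟩, y - P *ᵥ x, hy, by simp⟩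

lemma mem_lowerImage_iff (hq : 0 < q) {cbar : Fin q → ℝ} (hcq : cbar (lastIdx q hq) = 1)
    {w : Fin q → ℝ} : w ∈ Dmap b '' Tset A P Z cbar - RstarSet q hq ↔
      lowerLift hq cbar w ∈
        PointedCone.dual (homogPairing q).flip (homogCone A P Z b : Set _) := by
  constructor
  · rintro ⟨_, ⟨⟨u, ω⟩, ⟨l, hl, hω, hA, hc, hu⟩, rfl⟩, ρ, ⟨hρ, hρ'⟩, rfl⟩
    have h : lowerLift hq cbar (Dmap b (u, ω) - ρ) = (ω, ρ (lastIdx q hq) - b ⬝ᵥ u) := by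
      rw [lowerLift_eq_iff hq hcq]
      refine ⟨hc, fun i hi => ?_, ?_⟩
      · simp [Dmap, hi, hρ i hi]
      · simp [Dmap, not_lastIdx_lt hq]
    rw [h, mem_dual_homogCone_iff]
    exact ⟨u, l, hu, hl, hω, hA, by linarith⟩
  · intro h
    obtain ⟨hc, hw, hlast⟩ := (lowerLift_eq_iff hq hcq w _).1 rfl
    rw [← Prod.mk.eta (p := lowerLift hq cbar w)] at h
    obtain ⟨u, l, hu, hl, hv, hA, hs⟩ := mem_dual_homogCone_iff.1 h
    refine ⟨_, ⟨(u, (lowerLift hq cbar w).1), ⟨l, hl, hv, hA, hc, hu⟩, rfl⟩,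
      Dmap b (u, (lowerLift hq cbar w).1) - w, ⟨fun i hi => ?_, ?_⟩, sub_sub_cancel _ _⟩
    · simp [Dmap, hi, hw i hi]
    · simp only [Pi.sub_apply, Dmap, not_lastIdx_lt, if_false]
      linarith

lemma upperLift_image_upperImage :
    upperLift q '' (P.mulVec '' {x | b ≤ A *ᵥ x} + {y | 0 ≤ Zᵀ *ᵥ y}) =
      coneSlice (homogPairing q) (homogCone A P Z b) (0, 1) := by
  ext ξ
  constructor
  · rintro ⟨y, hy, rfl⟩
    exact ⟨mem_upperImage_iff.1 hy, by simp⟩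
  · obtain ⟨y, t⟩ := ξ
    rintro ⟨h, h'⟩
    obtain rfl : t = 1 := by simpa using h'
    exact ⟨y, mem_upperImage_iff.2 h, rfl⟩

lemma lowerLift_image_lowerImage (hq : 0 < q) {cbar : Fin q → ℝ}
    (hcq : cbar (lastIdx q hq) = 1) :
    lowerLift hq cbar '' (Dmap b '' Tset A P Z cbar - RstarSet q hq) =
      coneSlice (homogPairing q).flip
        (PointedCone.dual (homogPairing q).flip (homogCone A P Z b : Set _)) (cbar, 0) := by
  ext ξ
  constructor
  · rintro ⟨w, hw, rfl⟩
    refine ⟨(mem_lowerImage_iff hq hcq).1 hw, ?_⟩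
    have := ((lowerLift_eq_iff hq hcq w _).1 rfl).1
    simpa [dotProduct_comm] using this
  · rintro ⟨h, h'⟩
    have hc : cbar ⬝ᵥ ξ.1 = 1 := by simpa [dotProduct_comm] using h'
    have hw : lowerLift hq cbar (fun i => if (i : ℕ) < q - 1 then ξ.1 i else -ξ.2) = ξ := by
      rw [lowerLift_eq_iff hq hcq]
      exact ⟨hc, fun i hi => by simp [hi], by simp [not_lastIdx_lt hq]⟩
    exact ⟨_, (mem_lowerImage_iff hq hcq).2 (hw.symm ▸ h), hw⟩

end Slices

/-- The direction `(0, …, 0, -1)`. -/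
def lowerDir {q : ℕ} (hq : 0 < q) : Fin q → ℝ := -Pi.single (lastIdx q hq) 1

lemma lowerLift_linear_lowerDir {q : ℕ} (hq : 0 < q) (cbar : Fin q → ℝ) :
    (lowerLift hq cbar).linear (lowerDir hq) = (0, 1) := by
  have h : ∀ i : Fin q, (i : ℕ) < q - 1 → lowerDir hq i = 0 := fun i hi => by
    have : i ≠ lastIdx q hq := fun h => not_lastIdx_lt hq (h ▸ hi)
    simp [lowerDir, this]
  rw [lowerLift_linear]
  refine Prod.ext (funext fun i => ?_) (by simp [lowerLiftLinear, lowerDir])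
  have h' : ∀ j : Fin q, (if (j : ℕ) < q - 1 then cbar j * lowerDir hq j else 0) = 0 := fun j => by
    split_ifs with hj
    · simp [h j hj]
    · rfl
  by_cases hi : (i : ℕ) < q - 1
  · simp [lowerLiftLinear, hi, h i hi]
  · simp [lowerLiftLinear, hi, h']

lemma mem_RstarSet_diff_zero_iff {q : ℕ} (hq : 0 < q) {v : Fin q → ℝ} :
    v ∈ RstarSet q hq \ {0} ↔ ∃ ε : ℝ, 0 < ε ∧ v = -(ε • lowerDir hq) := by
  constructor
  · rintro ⟨⟨hv, hv'⟩, hv0⟩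
    have h : v = -(v (lastIdx q hq) • lowerDir hq) := funext fun i => by
      by_cases hi : (i : ℕ) < q - 1
      · have : i ≠ lastIdx q hq := fun h => not_lastIdx_lt hq (h ▸ hi)
        simp [lowerDir, this, hv i hi]
      · rw [eq_lastIdx_of_not_lt hq hi]
        simp [lowerDir]
    refine ⟨_, hv'.lt_of_ne' fun h0 => hv0 ?_, h⟩
    rw [h, h0]
    simp
  · rintro ⟨ε, hε, rfl⟩
    refine ⟨⟨fun i hi => ?_, ?_⟩, fun h => ?_⟩
    · have : i ≠ lastIdx q hq := fun h => not_lastIdx_lt hq (h ▸ hi)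
      simp [lowerDir, this]
    · simpa [lowerDir] using hε.le
    · have := congrFun h (lastIdx q hq)
      simp [lowerDir, hε.ne'] at this

lemma mem_coneOf_singleton_diff_zero_iff {E : Type*} [AddCommGroup E] [Module ℝ E] {c v : E}
    (hc : c ≠ 0) : v ∈ coneOf {c} \ {0} ↔ ∃ ε : ℝ, 0 < ε ∧ v = ε • c := by
  simp only [coneOf, convexHull_singleton, mem_singleton_iff, exists_eq_left, mem_sdiff,
    mem_ofPred_eq]
  constructor
  · rintro ⟨⟨l, hl, rfl⟩, h⟩
    exact ⟨l, hl.lt_of_ne' fun h0 => h (by simp [h0]), rfl⟩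
  · rintro ⟨l, hl, rfl⟩
    exact ⟨⟨l, hl.le, rfl⟩, smul_ne_zero hl.ne' hc⟩

lemma IsMinFace.ne {E : Type*} [AddCommGroup E] [Module ℝ E] {B F : Set E} {k : E}
    (hF : IsMinFace B k F) (hB : ∀ x ∈ B, x + k ∈ B) : F ≠ B := by
  rintro rfl
  obtain ⟨x, hx⟩ := hF.2.1
  exact hF.2.2 _ (hB x hx) 1 one_pos (by simpa using hx)

lemma convex_preimage_pointedCone {E N : Type*} [AddCommGroup E] [Module ℝ E] [AddCommGroup N]
    [Module ℝ N] (f : E →ᵃ[ℝ] N) (K : PointedCone ℝ N) : Convex ℝ {x | f x ∈ K} := by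
  have hK : Convex ℝ (K : Set N) := K.convex
  exact hK.affine_preimage f

/-- Points of the preimage of a cone under an affine map can be moved along directions in the
cone. -/
lemma add_mem_of_linear_mem {E N : Type*} [AddCommGroup E] [Module ℝ E] [AddCommGroup N]
    [Module ℝ N] {f : E →ᵃ[ℝ] N} {K : PointedCone ℝ N} {x c : E} (hx : f x ∈ K)
    (hc : f.linear c ∈ K) : f (x + c) ∈ K := by
  rw [add_comm, ← vadd_eq_add, f.map_vadd]
  exact add_mem hc hx

lemma biInter_setOf_mem_and {α β : Type*} {B : Set α} {I : Set β} (hI : I.Nonempty)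
    (Q : α → β → Prop) : ⋂ i ∈ I, {x ∈ B | Q x i} = {x ∈ B | ∀ i ∈ I, Q x i} := by
  ext x
  simp only [mem_iInter, mem_ofPred_eq]
  exact ⟨fun h => ⟨(h _ hI.some_mem).1, fun i hi => (h i hi).2⟩, fun h i hi => ⟨h.1, h.2 i hi⟩⟩

/-- Geometric duality theorem. -/
theorem stmt2
    (m n q r : ℕ) (hm : 0 < m) (hn : 0 < n) (hq : 0 < q) (hr : 0 < r)
    (A : Matrix (Fin m) (Fin n) ℝ) (P : Matrix (Fin q) (Fin n) ℝ)
    (Z : Matrix (Fin q) (Fin r) ℝ) (b : Fin m → ℝ)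
    (C : Set (Fin q → ℝ)) (hC : C = {y | 0 ≤ Zᵀ.mulVec y})
    (hCpointed : C ∩ -C = {0}) (hCnontriv : C ≠ {0})
    (S : Set (Fin n → ℝ)) (hS : S = {x | b ≤ A.mulVec x}) (hSne : S.Nonempty)
    (UpImg : Set (Fin q → ℝ)) (hUp : UpImg = P.mulVec '' S + C)
    (cbar : Fin q → ℝ) (hcbar : cbar ∈ intrinsicInterior ℝ C)
    (hcq : cbar (lastIdx q hq) = 1)
    (R : Set (Fin q → ℝ)) (hR : R = coneOf {cbar})
    (T : Set ((Fin m → ℝ) × (Fin q → ℝ))) (hT : T = Tset A P Z cbar) (hTne : T.Nonempty)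
    (LowImg : Set (Fin q → ℝ)) (hLow : LowImg = Dmap b '' T - RstarSet q hq)
    -- `R`-minimal proper faces of the upper image
    (RMinPF : Set (Fin q → ℝ) → Prop)
    (hRMin : ∀ F, RMinPF F ↔ IsFaceOf F UpImg ∧ F.Nonempty ∧ F ≠ UpImg ∧
      ∀ y ∈ F, y ∉ UpImg + (R \ {0}))
    -- `R*`-maximal proper faces of the lower image
    (RMaxPF : Set (Fin q → ℝ) → Prop)
    (hRMax : ∀ Fs, RMaxPF Fs ↔ IsFaceOf Fs LowImg ∧ Fs.Nonempty ∧ Fs ≠ LowImg ∧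
      ∀ w ∈ Fs, ¬ ∃ w' ∈ LowImg, w' - w ∈ RstarSet q hq \ {0}) :
    -- Ψ maps R*-maximal proper faces to R-minimal proper faces
    (∀ Fs, RMaxPF Fs → RMinPF (PsiMap hq cbar UpImg Fs)) ∧
    -- Ψ is a one-to-one map onto the R-minimal proper faces
    (∀ F, RMinPF F → ∃! Fs, RMaxPF Fs ∧ PsiMap hq cbar UpImg Fs = F) ∧
    -- Ψ is inclusion reversing
    (∀ Fs1 Fs2, RMaxPF Fs1 → RMaxPF Fs2 →
      (Fs1 ⊆ Fs2 ↔ PsiMap hq cbar UpImg Fs2 ⊆ PsiMap hq cbar UpImg Fs1)) ∧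
    -- the inverse map is `F ↦ ⋂_{y ∈ F} {w ∈ 𝒟 : φ(y,w) = 0}`
    (∀ Fs, RMaxPF Fs →
      (⋂ y ∈ PsiMap hq cbar UpImg Fs, {w ∈ LowImg | phiFn hq cbar y w = 0}) = Fs) ∧
    -- dimension formula
    (∀ Fs, RMaxPF Fs → sdim Fs + sdim (PsiMap hq cbar UpImg Fs) = q - 1) := by
  set p := homogPairing q
  set K := homogCone A P Z b
  set Kd := PointedCone.dual p.flip (K : Set _)
  set f := upperLift q
  set g := lowerLift hq cbar
  set d := lowerDir hq
  have hUp' : ∀ y, y ∈ UpImg ↔ f y ∈ K := fun y => by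
    rw [hUp, hC, hS]; exact mem_upperImage_iff
  have hLow' : ∀ w, w ∈ LowImg ↔ g w ∈ Kd := fun w => by
    rw [hLow, hT]; exact mem_lowerImage_iff hq hcq
  have hB₁ : f '' UpImg = coneSlice p K (g.linear d) := by
    rw [hUp, hC, hS, lowerLift_linear_lowerDir]; exact upperLift_image_upperImage
  have hB₂ : g '' LowImg = coneSlice p.flip Kd (f.linear cbar) := by
    rw [hLow, hT]; exact lowerLift_image_lowerImage hq hcq
  have hcC : 0 ≤ Zᵀ *ᵥ cbar := by
    have := intrinsicInterior_subset hcbar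
    rwa [hC] at this
  have hkK : f.linear cbar ∈ K :=
    mem_homogCone_iff.2 ⟨le_rfl, 0, by simp, by simpa using hcC⟩
  have heKd : g.linear d ∈ Kd := by
    rw [lowerLift_linear_lowerDir]
    exact mem_dual_homogCone_iff.2 ⟨0, 0, le_rfl, le_rfl, by simp, by simp, by simp⟩
  have hek : p (g.linear d) (f.linear cbar) = 0 := by
    simp [p, f, g, d, lowerLift_linear_lowerDir]
  have hKfg : K.FG := homogCone_fg
  have hKdual : K.DualFG p := PointedCone.dualFG_of_fg p hKfg
  have hKddual : Kd.DualFG p.flip := .dual_of_fg _ hKfg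
  have hKdd : PointedCone.dual p (Kd : Set _) = K := PointedCone.dual_dual_of_fg p hKfg
  have hdim : Module.finrank ℝ ((Fin q → ℝ) × ℝ) = q + 1 := by simp
  have hc0 : cbar ≠ 0 := fun h => by simp [h] at hcq
  have hmin : ∀ F, RMinPF F ↔ IsMinFace UpImg cbar F := fun F => by
    have h : ∀ y, y ∉ UpImg + (R \ {0}) ↔ ∀ ε : ℝ, 0 < ε → y - ε • cbar ∉ UpImg := fun y => by
      simp only [mem_add, hR, mem_coneOf_singleton_diff_zero_iff hc0]
      constructor
      · exact fun h ε hε hy => h ⟨_, hy, _, ⟨ε, hε, rfl⟩, by simp⟩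
      · rintro h ⟨z, hz, _, ⟨ε, hε, rfl⟩, rfl⟩
        exact h ε hε (by simpa using hz)
    simp only [hRMin, h]
    refine ⟨fun h => ⟨h.1, h.2.1, h.2.2.2⟩, fun h => ⟨h.1, h.2.1, ?_, h.2.2⟩⟩
    exact h.ne fun y hy => (hUp' _).2 (add_mem_of_linear_mem ((hUp' y).1 hy) hkK)
  have hmax : ∀ F, RMaxPF F ↔ IsMinFace LowImg d F := fun F => by
    have h : ∀ w, (¬ ∃ w' ∈ LowImg, w' - w ∈ RstarSet q hq \ {0}) ↔
        ∀ ε : ℝ, 0 < ε → w - ε • d ∉ LowImg := fun w => by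
      simp only [mem_RstarSet_diff_zero_iff]
      constructor
      · exact fun h ε hε hw => h ⟨_, hw, ε, hε, by simp [d]⟩
      · rintro h ⟨w', hw', ε, hε, hw⟩
        refine h ε hε ?_
        rwa [sub_eq_add_neg, ← hw, add_sub_cancel]
    simp only [hRMax, h]
    refine ⟨fun h => ⟨h.1, h.2.1, h.2.2.2⟩, fun h => ⟨h.1, h.2.1, ?_, h.2.2⟩⟩
    exact h.ne fun w hw => (hLow' _).2 (add_mem_of_linear_mem ((hLow' w).1 hw) heKd)
  have hPsi : ∀ Fs : Set (Fin q → ℝ), Fs.Nonempty → PsiMap hq cbar UpImg Fs =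
      {y ∈ UpImg | ∀ w ∈ Fs, p (g w) (f y) = 0} := fun Fs hFs => by
    simp only [PsiMap, phiFn_eq_homogPairing]
    exact biInter_setOf_mem_and hFs _
  have hPsi' : ∀ F : Set (Fin q → ℝ), F.Nonempty →
      (⋂ y ∈ F, {w ∈ LowImg | phiFn hq cbar y w = 0}) =
        {w ∈ LowImg | ∀ y ∈ F, p (g w) (f y) = 0} := fun F hF => by
    simp only [phiFn_eq_homogPairing]
    exact biInter_setOf_mem_and hF _
  have hUpConv : Convex ℝ UpImg := by
    rw [Set.ext hUp']; exact convex_preimage_pointedCone f K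
  have hLowConv : Convex ℝ LowImg := by
    rw [Set.ext hLow']; exact convex_preimage_pointedCone g Kd
  have hnn : ∀ y ∈ UpImg, ∀ w ∈ LowImg, 0 ≤ p (g w) (f y) := fun y hy w hw =>
    (hLow' w).1 hw ((hUp' y).1 hy)
  have hpc : ∀ w ∈ LowImg, p (g w) (f.linear cbar) = 1 := fun w hw =>
    (hB₂.subset (mem_image_of_mem g hw)).2
  have hpd : ∀ y ∈ UpImg, p (g.linear d) (f y) = 1 := fun y hy =>
    (hB₁.subset (mem_image_of_mem f hy)).2
  have hdual : ∀ Fs, IsMinFace LowImg d Fs → IsMinFace UpImg cbar (PsiMap hq cbar UpImg Fs) ∧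
      (⋂ y ∈ PsiMap hq cbar UpImg Fs, {w ∈ LowImg | phiFn hq cbar y w = 0}) = Fs ∧
      sdim Fs + sdim (PsiMap hq cbar UpImg Fs) = q - 1 := fun Fs hFs => by
    obtain ⟨h₁, h₂, h₃⟩ := hFs.polar_of_slices (p := p.flip) hKddual hKdd
      (lowerLift_injective hq cbar) (upperLift_injective q) heKd hek hB₂ hB₁
      (hPsi Fs hFs.2.1)
    refine ⟨?_, (hPsi' _ h₁).trans h₂, by omega⟩
    rw [hPsi Fs hFs.2.1] at h₁ ⊢
    exact isMinFace_setOf_forall_eq_zero hUpConv hFs.2.1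
      (fun w => (p (g w)).toAffineMap.comp f) (fun w hw y hy => hnn y hy w (hFs.1.2.1 hw))
      (fun w hw => hpc w (hFs.1.2.1 hw)) h₁
  have hprimal : ∀ F, IsMinFace UpImg cbar F → ∃ Fs, IsMinFace LowImg d Fs ∧
      PsiMap hq cbar UpImg Fs = F := fun F hF => by
    obtain ⟨h₁, h₂, -⟩ := hF.polar_of_slices hKdual rfl (upperLift_injective q)
      (lowerLift_injective hq cbar) hkK hek hB₁ hB₂ rfl
    refine ⟨_, ?_, (hPsi _ h₁).trans h₂⟩
    exact isMinFace_setOf_forall_eq_zero hLowConv hF.2.1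
      (fun y => (p.flip (f y)).toAffineMap.comp g) (fun y hy w hw => hnn y (hF.1.2.1 hy) w hw)
      (fun y hy => hpd y (hF.1.2.1 hy)) h₁
  simp only [hmin, hmax]
  refine ⟨fun Fs hFs => (hdual Fs hFs).1, fun F hF => ?_, fun Fs₁ Fs₂ h₁ h₂ =>
    ⟨fun h => biInter_subset_biInter_left h, fun h => ?_⟩, fun Fs hFs => (hdual Fs hFs).2.1,
    fun Fs hFs => (hdual Fs hFs).2.2⟩
  · obtain ⟨Fs, hFs, rfl⟩ := hprimal F hF
    refine ⟨Fs, ⟨hFs, rfl⟩, fun Gs ⟨hGs, h⟩ => ?_⟩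
    rw [← (hdual Gs hGs).2.1, h, (hdual Fs hFs).2.1]
  · rw [← (hdual Fs₁ h₁).2.1, ← (hdual Fs₂ h₂).2.1]
    exact biInter_subset_biInter_left h
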